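/- Let (Ω,d) be a bounded minimally nice metric space whose metric completion Ω̄^d is compact and such that (Ω,k_Ω) is Gromov hyperbolic, (Ω,d) is quasiconvex, and the Gehring–Hayman theorem holds in (Ω,d). Fix x₀ ∈ Ω and suppose k_Ω(x₀,x) ≤ φ(δ_Ω(x₀)/δ_Ω(x)) for all x ∈ Ω, where φ : (0,∞) → (0,∞) is a strictly increasing function with φ(t) → ∞ as t → ∞ and ∫₀^∞ dt/φ⁻¹(t) < ∞. Then the identity map id_Ω : (Ω,k_Ω) → (Ω,d) extends to a homeomorphism from the Gromov boundary ∂_GΩ onto the metric boundary ∂_dΩ. -/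

import Mathlib

open Set Filter Metric Topology UniformConvergence ENNReal

noncomputable section

variable {Ω : Type*} [MetricSpace Ω]

/-- The metric boundary `∂_dΩ` of a metric space `Ω`: the complement of (the image of) `Ω`
in its metric completion `Ω̄^d`. -/
def metricBoundary (Ω : Type*) [MetricSpace Ω] : Set (UniformSpace.Completion Ω) :=
  (Set.range ((↑) : Ω → UniformSpace.Completion Ω))ᶜ

/-- `δ_Ω(z)`: the distance from `z ∈ Ω` to the metric boundary `∂_dΩ`. -/
def deltaOmega (z : Ω) : ℝ :=
  Metric.infDist ((z : UniformSpace.Completion Ω)) (metricBoundary Ω)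

/-- A rectifiable curve in `Ω`, defined on `[a,b]`, joining `x` to `y`. -/
def IsCurveIn (γ : ℝ → Ω) (a b : ℝ) (x y : Ω) : Prop :=
  a ≤ b ∧ ContinuousOn γ (Set.Icc a b) ∧ γ a = x ∧ γ b = y ∧
    eVariationOn γ (Set.Icc a b) ≠ ⊤

/-- The `d`-arclength function `t ↦ ℓ_d(γ|_{[a,t]})` of a curve `γ` on `[a,b]` (clamped). -/
def arcLengthFun (γ : ℝ → Ω) (a b : ℝ) : ℝ → ℝ :=
  fun t => (eVariationOn γ (Set.Icc a (max a (min t b)))).toReal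

theorem arcLengthFun_monotone {γ : ℝ → Ω} {a b : ℝ} (hab : a ≤ b)
    (hrect : eVariationOn γ (Set.Icc a b) ≠ ⊤) : Monotone (arcLengthFun γ a b) := by
  intro s t hst
  apply ENNReal.toReal_mono
  · exact ne_top_of_le_ne_top hrect
      (eVariationOn.mono γ (Set.Icc_subset_Icc_right (max_le hab (min_le_right _ _))))
  · exact eVariationOn.mono γ (Set.Icc_subset_Icc_right
      (max_le_max le_rfl (min_le_min hst le_rfl)))

/-- The quasihyperbolic length `ℓ_k(γ) = ∫_γ |dz| / δ_Ω(z)` of a rectifiable curve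
`γ : [a,b] → Ω`: the Lebesgue–Stieltjes integral of `1/δ_Ω(γ(t))` with respect to the
arclength function of `γ`.  (Non-rectifiable "curves" get length `⊤`.) -/
def qhLength (γ : ℝ → Ω) (a b : ℝ) : ℝ≥0∞ :=
  if h : a ≤ b ∧ eVariationOn γ (Set.Icc a b) ≠ ⊤ then
    ∫⁻ t in Set.Icc a b, ENNReal.ofReal (1 / deltaOmega (γ t))
      ∂(arcLengthFun_monotone h.1 h.2).stieltjesFunction.measure
  else ⊤

/-- The quasihyperbolic distance (as an extended real): the infimum of the quasihyperbolic
lengths of rectifiable curves in `Ω` joining `x` to `y`. -/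
def qhEDist (x y : Ω) : ℝ≥0∞ :=
  ⨅ (γ : ℝ → Ω) (a : ℝ) (b : ℝ) (_ : IsCurveIn γ a b x y), qhLength γ a b

/-- The quasihyperbolic metric `k_Ω`. -/
def qhDist (x y : Ω) : ℝ :=
  (qhEDist x y).toReal

/-- The inner (length) metric `λ_Ω` associated to `(Ω,d)`, as an extended real. -/
def innerEDist (x y : Ω) : ℝ≥0∞ :=
  ⨅ (γ : ℝ → Ω) (a : ℝ) (b : ℝ) (_ : IsCurveIn γ a b x y), eVariationOn γ (Set.Icc a b)

/-- `(Ω,d)` is minimally nice: rectifiably connected, locally compact, non-complete, and the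
identity map from `(Ω,d)` to `(Ω,λ_Ω)` is continuous. -/
structure MinimallyNice (Ω : Type*) [MetricSpace Ω] : Prop where
  rectifiablyConnected : ∀ x y : Ω, ∃ (γ : ℝ → Ω) (a b : ℝ), IsCurveIn γ a b x y
  locallyCompact : LocallyCompactSpace Ω
  nonComplete : ¬ CompleteSpace Ω
  idContinuous : ∀ x : Ω, Filter.Tendsto (fun y => innerEDist x y) (nhds x) (nhds 0)

/-- `γ` is a geodesic of the quasihyperbolic metric on the parameter set `s`
(parametrized by `k_Ω`-arclength). -/
def IsQHGeodesicOn (γ : ℝ → Ω) (s : Set ℝ) : Prop :=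
  ∀ ⦃u⦄, u ∈ s → ∀ ⦃v⦄, v ∈ s → qhDist (γ u) (γ v) = |u - v|

/-- A quasihyperbolic geodesic segment from `x` to `y`. -/
def IsQHGeodesicSeg (γ : ℝ → Ω) (a b : ℝ) (x y : Ω) : Prop :=
  a ≤ b ∧ γ a = x ∧ γ b = y ∧ IsQHGeodesicOn γ (Set.Icc a b)

/-- A quasihyperbolic geodesic ray `γ : [0,∞) → (Ω, k_Ω)`. -/
def IsQHGeodesicRay (γ : ℝ → Ω) : Prop :=
  IsQHGeodesicOn γ (Set.Ici 0)

/-- A quasihyperbolic geodesic line `γ : (-∞,∞) → (Ω, k_Ω)`. -/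
def IsQHGeodesicLine (γ : ℝ → Ω) : Prop :=
  IsQHGeodesicOn γ Set.univ

/-- `(Ω,d)` is quasihyperbolically visible: for every pair of distinct points `p,q` of the
metric boundary there is a compact set `K ⊆ Ω` such that for all sequences `xₙ → p`, `yₙ → q`
(in the metric `d`), every quasihyperbolic geodesic joining `xₙ` and `yₙ` meets `K`. -/
def QHVisible (Ω : Type*) [MetricSpace Ω] : Prop :=
  ∀ p q : UniformSpace.Completion Ω, p ∈ metricBoundary Ω → q ∈ metricBoundary Ω → p ≠ q →
    ∃ K : Set Ω, IsCompact K ∧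
      ∀ x y : ℕ → Ω,
        Filter.Tendsto (fun n => ((x n : Ω) : UniformSpace.Completion Ω))
          Filter.atTop (nhds p) →
        Filter.Tendsto (fun n => ((y n : Ω) : UniformSpace.Completion Ω))
          Filter.atTop (nhds q) →
        ∀ (n : ℕ) (γ : ℝ → Ω) (a b : ℝ), IsQHGeodesicSeg γ a b (x n) (y n) →
          ∃ t ∈ Set.Icc a b, γ t ∈ K

/-- `(Ω, k_Ω)` is Gromov hyperbolic: there is `δ ≥ 0` such that every quasihyperbolic
geodesic triangle is `δ`-thin. -/
def QHGromovHyperbolic (Ω : Type*) [MetricSpace Ω] : Prop :=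
  ∃ δ : ℝ, 0 ≤ δ ∧
    ∀ (x y z : Ω) (γ₁ γ₂ γ₃ : ℝ → Ω) (a₁ b₁ a₂ b₂ a₃ b₃ : ℝ),
      IsQHGeodesicSeg γ₁ a₁ b₁ x y → IsQHGeodesicSeg γ₂ a₂ b₂ y z →
      IsQHGeodesicSeg γ₃ a₃ b₃ x z →
      ∀ t ∈ Set.Icc a₁ b₁,
        ∃ u, (u ∈ Set.Icc a₂ b₂ ∧ qhDist (γ₁ t) (γ₂ u) ≤ δ) ∨
             (u ∈ Set.Icc a₃ b₃ ∧ qhDist (γ₁ t) (γ₃ u) ≤ δ)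

/-- `(Ω,d)` is quasiconvex: some `A ≥ 1` so that every two points are joined by a curve of
`d`-length at most `A·d(x,y)`. -/
def QuasiconvexSpace (Ω : Type*) [MetricSpace Ω] : Prop :=
  ∃ A : ℝ, 1 ≤ A ∧ ∀ x y : Ω, ∃ (γ : ℝ → Ω) (a b : ℝ), IsCurveIn γ a b x y ∧
    eVariationOn γ (Set.Icc a b) ≤ ENNReal.ofReal (A * dist x y)

/-- The Gehring–Hayman theorem holds in `(Ω,d)`: quasihyperbolic geodesics are essentially
the shortest curves, up to a multiplicative constant `C ≥ 1`. -/
def GehringHayman (Ω : Type*) [MetricSpace Ω] : Prop :=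
  ∃ C : ℝ, 1 ≤ C ∧ ∀ x y : Ω, ∀ (γ : ℝ → Ω) (a b : ℝ), IsQHGeodesicSeg γ a b x y →
    ∀ (σ : ℝ → Ω) (a' b' : ℝ), IsCurveIn σ a' b' x y →
      eVariationOn γ (Set.Icc a b) ≤ ENNReal.ofReal C * eVariationOn σ (Set.Icc a' b')
/-- The space of quasihyperbolic geodesic rays emanating from the base point `x₀`, endowed
with the topology of uniform convergence on compact subsets of `[0,∞)`. -/
def RaySpace (Ω : Type*) [MetricSpace Ω] (x₀ : Ω) : Type _ :=
  {γ : ℝ → Ω // IsQHGeodesicRay γ ∧ γ 0 = x₀}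

instance (x₀ : Ω) : TopologicalSpace (RaySpace Ω x₀) :=
  TopologicalSpace.induced
    (fun γ : RaySpace Ω x₀ => UniformOnFun.ofFun {K : Set ℝ | IsCompact K} γ.1)
    inferInstance

/-- Two geodesic rays from `x₀` are equivalent if they stay at bounded quasihyperbolic
distance from each other. -/
def RayEquiv (x₀ : Ω) (γ σ : RaySpace Ω x₀) : Prop :=
  ∃ M : ℝ, ∀ t : ℝ, 0 ≤ t → qhDist (γ.1 t) (σ.1 t) ≤ M

/-- The Gromov boundary `∂_GΩ` of `(Ω, k_Ω)` with base point `x₀`: equivalence classes of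
quasihyperbolic geodesic rays from `x₀`, with the quotient topology. -/
def GromovBoundary (Ω : Type*) [MetricSpace Ω] (x₀ : Ω) : Type _ :=
  Quot (RayEquiv x₀)

instance (x₀ : Ω) : TopologicalSpace (GromovBoundary Ω x₀) :=
  inferInstanceAs (TopologicalSpace (Quot (RayEquiv x₀)))

lemma qx_arc_of_le (γ : ℝ → Ω) {a b t : ℝ} (ht : t ≤ a) : arcLengthFun γ a b t = 0 := by
  have : max a (min t b) = a := max_eq_left ((min_le_left _ _).trans ht)
  simp [arcLengthFun, this, eVariationOn.subsingleton]

lemma qx_arc_of_ge (γ : ℝ → Ω) {a b t : ℝ} (hab : a ≤ b) (ht : b ≤ t) :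
    arcLengthFun γ a b t = (eVariationOn γ (Icc a b)).toReal := by
  have : max a (min t b) = b := by rw [min_eq_right ht, max_eq_right hab]
  simp [arcLengthFun, this]

lemma qx_evar_add (γ : ℝ → Ω) {a b c : ℝ} (hab : a ≤ b) (hbc : b ≤ c) :
    eVariationOn γ (Icc a b) + eVariationOn γ (Icc b c) = eVariationOn γ (Icc a c) := by
  have := eVariationOn.Icc_add_Icc γ (s := univ) hab hbc (mem_univ b)
  simpa using this

lemma qx_rect_left {γ : ℝ → Ω} {a b c : ℝ} (hbc : b ≤ c)
    (h : eVariationOn γ (Icc a c) ≠ ⊤) : eVariationOn γ (Icc a b) ≠ ⊤ :=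
  ne_top_of_le_ne_top h (eVariationOn.mono γ (Icc_subset_Icc_right hbc))

lemma qx_rect_right {γ : ℝ → Ω} {a b c : ℝ} (hab : a ≤ b)
    (h : eVariationOn γ (Icc a c) ≠ ⊤) : eVariationOn γ (Icc b c) ≠ ⊤ :=
  ne_top_of_le_ne_top h (eVariationOn.mono γ (Icc_subset_Icc_left hab))

lemma qx_arc_add (γ : ℝ → Ω) {a b c : ℝ} (hab : a ≤ b) (hbc : b ≤ c)
    (h : eVariationOn γ (Icc a c) ≠ ⊤) (t : ℝ) :
    arcLengthFun γ a c t = arcLengthFun γ a b t + arcLengthFun γ b c t := by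
  rcases le_total t b with ht | ht
  · rw [qx_arc_of_le γ ht, add_zero]
    simp [arcLengthFun, min_eq_left ht, min_eq_left (ht.trans hbc)]
  · rw [qx_arc_of_ge γ hab ht]
    unfold arcLengthFun
    have h1 : b ≤ min t c := le_min ht hbc
    rw [max_eq_right h1, max_eq_right (hab.trans h1), ← ENNReal.toReal_add, qx_evar_add γ hab h1]
    · exact qx_rect_left hbc h
    · exact qx_rect_left (min_le_right _ _) (qx_rect_right hab h)

/-- the arclength measure -/
def qx_mu (γ : ℝ → Ω) (a b : ℝ) (hab : a ≤ b) (h : eVariationOn γ (Icc a b) ≠ ⊤) :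
    MeasureTheory.Measure ℝ :=
  (arcLengthFun_monotone hab h).stieltjesFunction.measure

lemma qx_rightLim_of_ge {γ : ℝ → Ω} {a b t : ℝ} (hab : a ≤ b) (ht : b ≤ t) :
    Function.rightLim (arcLengthFun γ a b) t = (eVariationOn γ (Icc a b)).toReal := by
  apply rightLim_eq_of_tendsto
  · apply tendsto_const_nhds.congr'
    filter_upwards [self_mem_nhdsWithin] with s hs
    exact (qx_arc_of_ge γ hab (ht.trans (le_of_lt hs))).symm

lemma qx_rightLim_of_lt {γ : ℝ → Ω} {a b t : ℝ} (ht : t < a) :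
    Function.rightLim (arcLengthFun γ a b) t = 0 := by
  apply rightLim_eq_of_tendsto
  · apply tendsto_const_nhds.congr'
    filter_upwards [mem_nhdsWithin_of_mem_nhds (Iio_mem_nhds ht)] with s hs
    exact (qx_arc_of_le γ (le_of_lt hs)).symm

lemma qx_tendsto_top {γ : ℝ → Ω} {a b : ℝ} (hab : a ≤ b) (h : eVariationOn γ (Icc a b) ≠ ⊤) :
    Tendsto (arcLengthFun_monotone hab h).stieltjesFunction atTop
      (𝓝 (eVariationOn γ (Icc a b)).toReal) := by
  apply tendsto_const_nhds.congr'
  filter_upwards [eventually_ge_atTop b] with s hs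
  rw [Monotone.stieltjesFunction_eq, qx_rightLim_of_ge hab hs]

lemma qx_tendsto_bot {γ : ℝ → Ω} {a b : ℝ} (hab : a ≤ b) (h : eVariationOn γ (Icc a b) ≠ ⊤) :
    Tendsto (arcLengthFun_monotone hab h).stieltjesFunction atBot (𝓝 0) := by
  apply tendsto_const_nhds.congr'
  filter_upwards [eventually_lt_atBot a] with s hs
  rw [Monotone.stieltjesFunction_eq, qx_rightLim_of_lt hs]

lemma qx_mu_univ {γ : ℝ → Ω} {a b : ℝ} (hab : a ≤ b) (h : eVariationOn γ (Icc a b) ≠ ⊤) :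
    qx_mu γ a b hab h univ = eVariationOn γ (Icc a b) := by
  unfold qx_mu
  rw [StieltjesFunction.measure_univ _ (qx_tendsto_bot hab h) (qx_tendsto_top hab h), sub_zero,
    ENNReal.ofReal_toReal h]

lemma qx_mu_compl {γ : ℝ → Ω} {a b : ℝ} (hab : a ≤ b) (h : eVariationOn γ (Icc a b) ≠ ⊤) :
    qx_mu γ a b hab h (Icc a b)ᶜ = 0 := by
  have h1 : qx_mu γ a b hab h (Iio a) = 0 := by
    unfold qx_mu
    rw [StieltjesFunction.measure_Iio _ (qx_tendsto_bot hab h), sub_zero]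
    have : Function.leftLim (arcLengthFun_monotone hab h).stieltjesFunction a = 0 := by
      apply leftLim_eq_of_tendsto
      · apply tendsto_const_nhds.congr'
        filter_upwards [self_mem_nhdsWithin] with s hs
        rw [Monotone.stieltjesFunction_eq, qx_rightLim_of_lt hs]
    rw [this]; simp
  have h2 : qx_mu γ a b hab h (Ioi b) = 0 := by
    unfold qx_mu
    rw [StieltjesFunction.measure_Ioi _ (qx_tendsto_top hab h), Monotone.stieltjesFunction_eq,
      qx_rightLim_of_ge hab le_rfl]
    simp
  refine MeasureTheory.measure_mono_null (t := Iio a ∪ Ioi b) ?_ (MeasureTheory.measure_union_null h1 h2)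
  intro t ht
  simp only [mem_compl_iff, mem_Icc, not_and_or, not_le] at ht
  exact ht

lemma qx_mu_restrict {γ : ℝ → Ω} {a b : ℝ} (hab : a ≤ b) (h : eVariationOn γ (Icc a b) ≠ ⊤)
    {s : Set ℝ} (hs : Icc a b ⊆ s) :
    (qx_mu γ a b hab h).restrict s = qx_mu γ a b hab h := by
  apply MeasureTheory.Measure.restrict_eq_self_of_ae_mem
  have := qx_mu_compl hab h
  refine MeasureTheory.measure_mono_null ?_ this
  exact compl_subset_compl.mpr hs

lemma qx_len_eq {γ : ℝ → Ω} {a b : ℝ} (hab : a ≤ b) (h : eVariationOn γ (Icc a b) ≠ ⊤) :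
    qhLength γ a b = ∫⁻ t, ENNReal.ofReal (1 / deltaOmega (γ t)) ∂(qx_mu γ a b hab h) := by
  unfold qhLength
  rw [dif_pos ⟨hab, h⟩]
  conv_rhs => rw [← qx_mu_restrict hab h subset_rfl]
  rfl

lemma qx_len_le {γ : ℝ → Ω} {a b : ℝ} (hab : a ≤ b) (h : eVariationOn γ (Icc a b) ≠ ⊤)
    {c : ℝ≥0∞} (hc : ∀ t ∈ Icc a b, ENNReal.ofReal (1 / deltaOmega (γ t)) ≤ c) :
    qhLength γ a b ≤ c * eVariationOn γ (Icc a b) := by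
  rw [qx_len_eq hab h, ← qx_mu_univ hab h, ← MeasureTheory.lintegral_const]
  apply MeasureTheory.lintegral_mono_ae
  exact MeasureTheory.measure_mono_null
    (fun t ht hm => ht (hc t hm)) (qx_mu_compl hab h)

lemma qx_len_ge {γ : ℝ → Ω} {a b : ℝ} (hab : a ≤ b) (h : eVariationOn γ (Icc a b) ≠ ⊤)
    {c : ℝ≥0∞} (hc : ∀ t ∈ Icc a b, c ≤ ENNReal.ofReal (1 / deltaOmega (γ t))) :
    c * eVariationOn γ (Icc a b) ≤ qhLength γ a b := by
  rw [qx_len_eq hab h, ← qx_mu_univ hab h, ← MeasureTheory.lintegral_const]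
  apply MeasureTheory.lintegral_mono_ae
  exact MeasureTheory.measure_mono_null
    (fun t ht hm => ht (hc t hm)) (qx_mu_compl hab h)

lemma qx_len_add {γ : ℝ → Ω} {a b c : ℝ} (hab : a ≤ b) (hbc : b ≤ c)
    (h : eVariationOn γ (Icc a c) ≠ ⊤) :
    qhLength γ a c = qhLength γ a b + qhLength γ b c := by
  rw [qx_len_eq (hab.trans hbc) h, qx_len_eq hab (qx_rect_left hbc h),
    qx_len_eq hbc (qx_rect_right hab h), ← MeasureTheory.lintegral_add_measure]
  congr 1
  unfold qx_mu
  rw [← StieltjesFunction.measure_add]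
  congr 1
  ext t
  rw [StieltjesFunction.add_apply]
  simp only [Monotone.stieltjesFunction_eq]
  apply rightLim_eq_of_tendsto
  · have e : arcLengthFun γ a c = fun t => arcLengthFun γ a b t + arcLengthFun γ b c t :=
      funext (qx_arc_add γ hab hbc h)
    rw [e]
    exact ((arcLengthFun_monotone hab (qx_rect_left hbc h)).tendsto_rightLim t).add
      ((arcLengthFun_monotone hbc (qx_rect_right hab h)).tendsto_rightLim t)

lemma qx_len_congr {γ γ' : ℝ → Ω} {a b : ℝ} (hab : a ≤ b) (h : eVariationOn γ (Icc a b) ≠ ⊤)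
    (he : EqOn γ γ' (Icc a b)) : qhLength γ a b = qhLength γ' a b := by
  have h' : eVariationOn γ' (Icc a b) ≠ ⊤ := by rwa [← eVariationOn.congr he]
  rw [qx_len_eq hab h, qx_len_eq hab h']
  have : qx_mu γ a b hab h = qx_mu γ' a b hab h' := by
    unfold qx_mu
    congr 2
    ext t
    unfold arcLengthFun
    rw [eVariationOn.congr (he.mono (Icc_subset_Icc_right (max_le hab (min_le_right _ _))))]
  rw [← this]
  apply MeasureTheory.lintegral_congr_ae
  refine MeasureTheory.measure_mono_null ?_ (qx_mu_compl hab h)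
  intro t ht hm
  apply ht
  show ENNReal.ofReal (1 / deltaOmega (γ t)) = ENNReal.ofReal (1 / deltaOmega (γ' t))
  rw [he hm]

lemma qx_evar_rev (γ : ℝ → Ω) (a b c : ℝ) :
    eVariationOn (fun t => γ (c - t)) (Icc a b) = eVariationOn γ (Icc (c - b) (c - a)) := by
  have := eVariationOn.comp_eq_of_antitoneOn γ (t := Icc a b) (fun t => c - t)
    (fun x _ y _ hxy => sub_le_sub_left hxy c)
  rw [Set.image_const_sub_Icc] at this
  exact this

lemma qx_len_rev {γ : ℝ → Ω} {a b : ℝ} (c : ℝ) (hab : a ≤ b) (h : eVariationOn γ (Icc a b) ≠ ⊤) :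
    qhLength (fun t => γ (c - t)) (c - b) (c - a) = qhLength γ a b := by
  have hab' : c - b ≤ c - a := by linarith
  have e : ∀ s t, eVariationOn (fun t => γ (c - t)) (Icc (c - s) (c - t)) =
      eVariationOn γ (Icc t s) := fun s t => by rw [qx_evar_rev]; simp
  have h' : eVariationOn (fun t => γ (c - t)) (Icc (c - b) (c - a)) ≠ ⊤ := by rwa [e]
  rw [qx_len_eq hab h, qx_len_eq hab' h']
  have harc : ∀ t, arcLengthFun (fun t => γ (c - t)) (c - b) (c - a) t =
      (eVariationOn γ (Icc a b)).toReal - arcLengthFun γ a b (c - t) := by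
    intro t
    have hm1 : a ≤ max a (min (c - t) b) := le_max_left _ _
    have hm2 : max a (min (c - t) b) ≤ b := max_le hab (min_le_right _ _)
    have hm : max (c - b) (min t (c - a)) = c - max a (min (c - t) b) := by
      simp only [max_def, min_def]; split_ifs <;> linarith
    unfold arcLengthFun
    rw [hm, e, ← qx_evar_add γ hm1 hm2, ENNReal.toReal_add]
    · ring
    · exact qx_rect_left hm2 h
    · exact qx_rect_right hm1 h
  have key : qx_mu (fun t => γ (c - t)) (c - b) (c - a) hab' h' =
      (qx_mu γ a b hab h).map (MeasurableEquiv.subLeft c) := by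
    unfold qx_mu
    apply MeasureTheory.Measure.ext_of_Ioc
    intro s t hst
    rw [MeasurableEquiv.map_apply, StieltjesFunction.measure_Ioc]
    have : (MeasurableEquiv.subLeft c) ⁻¹' (Ioc s t) = Ico (c - t) (c - s) := by
      ext x
      show (s < c - x ∧ c - x ≤ t) ↔ (c - t ≤ x ∧ x < c - s)
      constructor <;> intro hx <;> constructor <;> linarith [hx.1, hx.2]
    rw [this, StieltjesFunction.measure_Ico]
    have hmono := arcLengthFun_monotone hab h
    have l1 : ∀ x, Function.leftLim hmono.stieltjesFunction x
        = Function.leftLim (arcLengthFun γ a b) x := fun x =>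
      leftLim_rightLim (hmono.tendsto_leftLim x)
    have l2 : ∀ x, Function.rightLim (arcLengthFun (fun t => γ (c - t)) (c - b) (c - a)) x =
        (eVariationOn γ (Icc a b)).toReal - Function.leftLim (arcLengthFun γ a b) (c - x) := by
      intro x
      apply rightLim_eq_of_tendsto
      · rw [funext harc]
        apply tendsto_const_nhds.sub
        apply (hmono.tendsto_leftLim (c - x)).comp
        apply tendsto_nhdsWithin_of_tendsto_nhds_of_eventually_within
        · exact ((continuous_const.sub continuous_id).tendsto x).mono_left nhdsWithin_le_nhds
        · filter_upwards [self_mem_nhdsWithin] with y hy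
          simpa using hy
    rw [l1, l1, Monotone.stieltjesFunction_eq, Monotone.stieltjesFunction_eq, l2, l2]
    congr 1; ring
  rw [key, MeasureTheory.lintegral_map_equiv]
  have : ∀ t, (MeasurableEquiv.subLeft c) t = c - t := fun t => rfl
  simp [this]

lemma qx_curve_rev {γ : ℝ → Ω} {a b : ℝ} {x y : Ω} (c : ℝ) (h : IsCurveIn γ a b x y) :
    IsCurveIn (fun t => γ (c - t)) (c - b) (c - a) y x := by
  obtain ⟨hab, hc, ha, hb, hr⟩ := h
  refine ⟨by linarith, ?_, by simpa using hb, by simpa using ha, ?_⟩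
  · apply hc.comp (by fun_prop)
    intro t ht
    constructor <;> linarith [ht.1, ht.2]
  · rw [qx_evar_rev]; simpa using hr

lemma qx_curve_sub {γ : ℝ → Ω} {a b s t : ℝ} {x y : Ω} (h : IsCurveIn γ a b x y)
    (has : a ≤ s) (hst : s ≤ t) (htb : t ≤ b) : IsCurveIn γ s t (γ s) (γ t) :=
  ⟨hst, h.2.1.mono (Icc_subset_Icc has htb), rfl, rfl,
    qx_rect_left htb (qx_rect_right has h.2.2.2.2)⟩

lemma qx_e_le {γ : ℝ → Ω} {a b : ℝ} {x y : Ω} (h : IsCurveIn γ a b x y) :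
    qhEDist x y ≤ qhLength γ a b :=
  iInf_le_of_le γ (iInf_le_of_le a (iInf_le_of_le b (iInf_le _ h)))

lemma qx_e_comm_le (x y : Ω) : qhEDist x y ≤ qhEDist y x := by
  refine le_iInf fun γ => le_iInf fun a => le_iInf fun b => le_iInf fun h => ?_
  refine (qx_e_le (qx_curve_rev 0 h)).trans ?_
  rw [qx_len_rev 0 h.1 h.2.2.2.2]

lemma qx_e_comm (x y : Ω) : qhEDist x y = qhEDist y x :=
  le_antisymm (qx_e_comm_le x y) (qx_e_comm_le y x)

lemma qx_k_comm (x y : Ω) : qhDist x y = qhDist y x := by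
  unfold qhDist; rw [qx_e_comm]

lemma qx_curve_concat {γ₁ γ₂ : ℝ → Ω} {a b c : ℝ} {x y z : Ω} (h₁ : IsCurveIn γ₁ a b x y)
    (h₂ : IsCurveIn γ₂ b c y z) : ∃ γ, IsCurveIn γ a c x z ∧
      qhLength γ a c = qhLength γ₁ a b + qhLength γ₂ b c := by
  obtain ⟨hab, hc1, ha1, hb1, hr1⟩ := h₁
  obtain ⟨hbc, hc2, ha2, hb2, hr2⟩ := h₂
  let γ : ℝ → Ω := fun t => if t ≤ b then γ₁ t else γ₂ t
  have e1 : EqOn γ₁ γ (Icc a b) := fun t ht => by simp [γ, ht.2]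
  have e2 : EqOn γ₂ γ (Icc b c) := fun t ht => by
    rcases ht.1.eq_or_lt with rfl | h
    · simp [γ, hb1, ha2]
    · simp [γ, not_le.mpr h]
  have hr : eVariationOn γ (Icc a c) ≠ ⊤ := by
    rw [← qx_evar_add γ hab hbc, ← eVariationOn.congr e1, ← eVariationOn.congr e2]
    exact ENNReal.add_ne_top.mpr ⟨hr1, hr2⟩
  refine ⟨γ, ⟨hab.trans hbc, ?_, ?_, ?_, hr⟩, ?_⟩
  · rw [← Icc_union_Icc_eq_Icc hab hbc]
    exact (hc1.congr e1.symm).union_of_isClosed (hc2.congr e2.symm) isClosed_Icc isClosed_Icc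
  · rw [← e1 ⟨le_rfl, hab⟩, ha1]
  · rw [← e2 ⟨hbc, le_rfl⟩, hb2]
  · rw [qx_len_add hab hbc hr, qx_len_congr hab hr1 e1, qx_len_congr hbc hr2 e2]

lemma qx_curve_shift {γ : ℝ → Ω} {a b : ℝ} {x y : Ω} (h : IsCurveIn γ a b x y) (c : ℝ) :
    ∃ γ', IsCurveIn γ' (c + a) (c + b) x y ∧ qhLength γ' (c + a) (c + b) = qhLength γ a b := by
  have h1 := qx_curve_rev 0 h
  have h2 := qx_curve_rev c h1
  have e1 := qx_len_rev 0 h.1 h.2.2.2.2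
  have e2 := qx_len_rev c h1.1 h1.2.2.2.2
  have ea : c - (0 - a) = c + a := by ring
  have eb : c - (0 - b) = c + b := by ring
  rw [ea, eb] at h2 e2
  exact ⟨_, h2, e2.trans e1⟩

lemma qx_e_tri (x y z : Ω) : qhEDist x z ≤ qhEDist x y + qhEDist y z := by
  have key : ∀ γ₁ a b, IsCurveIn γ₁ a b x y → ∀ γ₂ a' b', IsCurveIn γ₂ a' b' y z →
      qhEDist x z ≤ qhLength γ₁ a b + qhLength γ₂ a' b' := by
    intro γ₁ a b h₁ γ₂ a' b' h₂
    obtain ⟨γ', h', e'⟩ := qx_curve_shift h₂ (b - a')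
    rw [sub_add_cancel] at h' e'
    obtain ⟨γ, h, e⟩ := qx_curve_concat h₁ h'
    rw [← e', ← e]
    exact qx_e_le h
  rw [qhEDist.eq_def x y, qhEDist.eq_def y z]
  simp only [ENNReal.iInf_add, ENNReal.add_iInf]
  refine le_iInf fun γ => le_iInf fun a => le_iInf fun b => le_iInf fun h => ?_
  refine le_iInf fun γ' => le_iInf fun a' => le_iInf fun b' => le_iInf fun h' => ?_
  first | exact key _ _ _ h _ _ _ h' | exact key _ _ _ h' _ _ _ h

/-- the basic hypotheses -/
structure QXB (Ω : Type*) [MetricSpace Ω] : Prop where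
  nice : MinimallyNice Ω
  cpt : CompactSpace (UniformSpace.Completion Ω)
  qc : QuasiconvexSpace Ω

lemma qx_bdry_nonempty (H : QXB Ω) : (metricBoundary Ω).Nonempty := by
  by_contra hne
  rw [Set.not_nonempty_iff_eq_empty] at hne
  apply H.nice.nonComplete
  have hs : Function.Surjective ((↑) : Ω → UniformSpace.Completion Ω) := by
    rw [← Set.range_eq_univ]
    exact Set.compl_empty_iff.mp hne
  exact (UniformSpace.Completion.isUniformInducing_coe Ω).completeSpace_congr hs |>.mpr inferInstance

lemma qx_pos (H : QXB Ω) (x : Ω) : 0 < deltaOmega x := by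
  have := H.nice.locallyCompact
  obtain ⟨K, hK, hx⟩ := exists_compact_mem_nhds x
  obtain ⟨r, hr, hrK⟩ := Metric.mem_nhds_iff.mp hx
  have : r / 2 ≤ deltaOmega x := by
    refine (Metric.le_infDist (qx_bdry_nonempty H)).mpr ?_
    intro p hp
    by_contra hlt
    push Not at hlt
    apply hp
    have hc : IsClosed ((↑) '' K : Set (UniformSpace.Completion Ω)) :=
      (hK.image (UniformSpace.Completion.continuous_coe Ω)).isClosed
    have : p ∈ ((↑) '' K : Set (UniformSpace.Completion Ω)) := by
      rw [← hc.closure_eq, Metric.mem_closure_iff]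
      intro ε hε
      obtain ⟨y, hy⟩ := (UniformSpace.Completion.denseRange_coe (α := Ω)).exists_dist_lt p
        (lt_min hε (half_pos hr))
      refine ⟨y, ⟨y, hrK ?_, rfl⟩, hy.trans_le (min_le_left _ _)⟩
      rw [mem_ball, ← UniformSpace.Completion.dist_eq]
      have h1 := hy.trans_le (min_le_right _ _)
      have := dist_triangle_left (y : UniformSpace.Completion Ω) x p
      rw [dist_comm p (x : UniformSpace.Completion Ω)] at this
      linarith
    obtain ⟨y, _, rfl⟩ := this
    exact ⟨y, rfl⟩
  linarith

lemma qx_lip (x y : Ω) : deltaOmega x ≤ deltaOmega y + dist x y := by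
  unfold deltaOmega
  rw [← UniformSpace.Completion.dist_eq]
  exact infDist_le_infDist_add_dist

lemma qx_delta_cont : Continuous (deltaOmega : Ω → ℝ) :=
  (Metric.continuous_infDist_pt _).comp (UniformSpace.Completion.continuous_coe Ω)

lemma qx_len_ne_top (H : QXB Ω) {γ : ℝ → Ω} {a b : ℝ} {x y : Ω} (h : IsCurveIn γ a b x y) :
    qhLength γ a b ≠ ⊤ := by
  obtain ⟨t, ht, hmin⟩ := isCompact_Icc.exists_isMinOn (nonempty_Icc.mpr h.1)
    (qx_delta_cont.comp_continuousOn h.2.1)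
  refine ne_top_of_le_ne_top ?_ (qx_len_le h.1 h.2.2.2.2 (c := ENNReal.ofReal (1 / deltaOmega (γ t))) ?_)
  · exact ENNReal.mul_ne_top ENNReal.ofReal_ne_top h.2.2.2.2
  · intro s hs
    apply ENNReal.ofReal_le_ofReal
    exact one_div_le_one_div_of_le (qx_pos H _) (hmin hs)

lemma qx_e_ne_top (H : QXB Ω) (x y : Ω) : qhEDist x y ≠ ⊤ := by
  obtain ⟨γ, a, b, h⟩ := H.nice.rectifiablyConnected x y
  exact ne_top_of_le_ne_top (qx_len_ne_top H h) (qx_e_le h)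

lemma qx_k_nonneg (x y : Ω) : 0 ≤ qhDist x y := ENNReal.toReal_nonneg

lemma qx_k_tri (H : QXB Ω) (x y z : Ω) : qhDist x z ≤ qhDist x y + qhDist y z := by
  unfold qhDist
  rw [← ENNReal.toReal_add (qx_e_ne_top H _ _) (qx_e_ne_top H _ _)]
  exact ENNReal.toReal_mono (ENNReal.add_ne_top.mpr ⟨qx_e_ne_top H _ _, qx_e_ne_top H _ _⟩)
    (qx_e_tri x y z)

lemma qx_k_le (H : QXB Ω) {γ : ℝ → Ω} {a b : ℝ} {x y : Ω} (h : IsCurveIn γ a b x y) :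
    qhDist x y ≤ (qhLength γ a b).toReal :=
  ENNReal.toReal_mono (qx_len_ne_top H h) (qx_e_le h)

lemma qx_k_self (x : Ω) : qhDist x x = 0 := by
  have h : IsCurveIn (fun _ => x) 0 0 x x := by
    refine ⟨le_rfl, continuousOn_const, rfl, rfl, ?_⟩
    rw [eVariationOn.subsingleton _ (by simp)]; simp
  have := qx_e_le h
  have h2 := qx_len_le h.1 h.2.2.2.2 (c := ENNReal.ofReal (1 / deltaOmega x)) (fun _ _ => le_rfl)
  rw [eVariationOn.subsingleton _ (by simp), mul_zero] at h2
  have : qhEDist x x = 0 := le_antisymm (this.trans h2) bot_le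
  simp [qhDist, this]

lemma qx_local_curve (H : QXB Ω) {γ : ℝ → Ω} {a b : ℝ} {x y : Ω} (h : IsCurveIn γ a b x y) :
    ENNReal.ofReal (dist x y / (deltaOmega x + dist x y)) ≤ qhLength γ a b := by
  obtain ⟨hab, hc, rfl, rfl, hr⟩ := h
  set L := (eVariationOn γ (Icc a b)).toReal with hL
  have hev : eVariationOn γ (Icc a b) = ENNReal.ofReal L := (ENNReal.ofReal_toReal hr).symm
  have hd : ∀ t ∈ Icc a b, dist (γ a) (γ t) ≤ L := by
    intro t ht
    have := eVariationOn.edist_le γ (s := Icc a b) (left_mem_Icc.mpr hab) ht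
    rw [dist_edist]
    exact ENNReal.toReal_mono hr this
  have hp := qx_pos H (γ a)
  have hL0 : 0 ≤ L := ENNReal.toReal_nonneg
  have h1 := qx_len_ge hab hr (c := ENNReal.ofReal (1 / (deltaOmega (γ a) + L))) (by
    intro t ht
    apply ENNReal.ofReal_le_ofReal
    apply one_div_le_one_div_of_le (qx_pos H _)
    have := qx_lip (γ t) (γ a)
    have := hd t ht
    rw [dist_comm] at this
    linarith)
  refine le_trans ?_ h1
  rw [hev, ← ENNReal.ofReal_mul (by positivity)]
  apply ENNReal.ofReal_le_ofReal
  have h2 := hd b (right_mem_Icc.mpr hab)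
  have h3 : 0 ≤ dist (γ a) (γ b) := dist_nonneg
  rw [one_div, inv_mul_eq_div, div_le_div_iff₀ (by positivity) (by positivity)]
  nlinarith

lemma qx_local (H : QXB Ω) (x y : Ω) :
    dist x y ≤ qhDist x y * (deltaOmega x + dist x y) := by
  have hp := qx_pos H x
  have h3 : 0 ≤ dist x y := dist_nonneg
  rw [← div_le_iff₀ (by positivity)]
  have : ENNReal.ofReal (dist x y / (deltaOmega x + dist x y)) ≤ qhEDist x y :=
    le_iInf fun γ => le_iInf fun a => le_iInf fun b => le_iInf fun h => qx_local_curve H h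
  have := ENNReal.toReal_mono (qx_e_ne_top H x y) this
  rwa [ENNReal.toReal_ofReal (by positivity)] at this

lemma qx_eq_of_zero (H : QXB Ω) {x y : Ω} (h : qhDist x y = 0) : x = y := by
  have := qx_local H x y
  rw [h, zero_mul] at this
  exact dist_le_zero.mp this

lemma qx_small (H : QXB Ω) {x y : Ω} (h : qhDist x y ≤ 1 / 2) : dist x y ≤ deltaOmega x := by
  have := qx_local H x y
  have hp := qx_pos H x
  have h3 : 0 ≤ dist x y := dist_nonneg
  nlinarith

lemma qx_k_upper (H : QXB Ω) : ∃ A : ℝ, 0 < A ∧ ∀ x y : Ω, A * dist x y ≤ deltaOmega x / 2 →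
    qhDist x y ≤ 2 * A / deltaOmega x * dist x y := by
  obtain ⟨A, hA, hq⟩ := H.qc
  refine ⟨A, by linarith, ?_⟩
  intro x y hxy
  obtain ⟨γ, a, b, h, hl⟩ := hq x y
  have hp := qx_pos H x
  have h3 : 0 ≤ dist x y := dist_nonneg
  have hup := qx_len_le h.1 h.2.2.2.2 (c := ENNReal.ofReal (2 / deltaOmega x)) (by
    intro t ht
    apply ENNReal.ofReal_le_ofReal
    rw [div_le_div_iff₀ (qx_pos H _) hp]
    have e1 := eVariationOn.edist_le γ (s := Icc a b) (left_mem_Icc.mpr h.1) ht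
    have e2 : dist x (γ t) ≤ A * dist x y := by
      rw [dist_edist, ← ENNReal.toReal_ofReal (show 0 ≤ A * dist x y by positivity)]
      apply ENNReal.toReal_mono ENNReal.ofReal_ne_top
      rw [← h.2.2.1]
      rw [h.2.2.1] at e1 ⊢
      exact e1.trans hl
    have := qx_lip x (γ t)
    linarith)
  have h4 := (qx_e_le h).trans (hup.trans (mul_le_mul_right hl _))
  rw [← ENNReal.ofReal_mul (by positivity)] at h4
  have h5 := ENNReal.toReal_mono ENNReal.ofReal_ne_top h4
  rw [ENNReal.toReal_ofReal (by positivity)] at h5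
  unfold qhDist
  refine h5.trans (le_of_eq ?_)
  ring

lemma qx_k_tendsto (H : QXB Ω) (x : Ω) : Tendsto (fun y => qhDist x y) (𝓝 x) (𝓝 0) := by
  obtain ⟨A, hA, hk⟩ := qx_k_upper H
  have hp := qx_pos H x
  have hd : Tendsto (fun y => dist x y) (𝓝 x) (𝓝 0) := by
    have := (continuous_const.dist continuous_id : Continuous (fun y => dist x y)).tendsto x
    simpa using this
  have h1 : Tendsto (fun y => 2 * A / deltaOmega x * dist x y) (𝓝 x) (𝓝 0) := by
    simpa using hd.const_mul (2 * A / deltaOmega x)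
  have h2 : Tendsto (fun y => A * dist x y) (𝓝 x) (𝓝 0) := by
    simpa using hd.const_mul A
  refine tendsto_of_tendsto_of_tendsto_of_le_of_le' tendsto_const_nhds h1
    (Eventually.of_forall fun y => qx_k_nonneg x y) ?_
  filter_upwards [h2.eventually (ge_mem_nhds (half_pos hp))] with y hy
  exact hk x y hy

lemma qx_k_tendsto2 (H : QXB Ω) {ι : Type*} {l : Filter ι} {f g : ι → Ω} {x y : Ω}
    (hf : Tendsto f l (𝓝 x)) (hg : Tendsto g l (𝓝 y)) :
    Tendsto (fun i => qhDist (f i) (g i)) l (𝓝 (qhDist x y)) := by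
  rw [tendsto_iff_dist_tendsto_zero]
  have h1 := (qx_k_tendsto H x).comp hf
  have h2 := (qx_k_tendsto H y).comp hg
  have h3 := h1.add h2
  rw [add_zero] at h3
  refine squeeze_zero (fun _ => dist_nonneg) ?_ h3
  intro i
  simp only [Function.comp]
  rw [Real.dist_eq, abs_le]
  have a1 := qx_k_tri H x (f i) y
  have a2 := qx_k_tri H (f i) (g i) y
  have a3 := qx_k_tri H (f i) x (g i)
  have a4 := qx_k_tri H x y (g i)
  rw [qx_k_comm (g i) y] at a2
  rw [qx_k_comm (f i) x] at a3
  constructor <;> linarith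

lemma qx_decay (H : QXB Ω) (n : ℕ) : ∀ {γ : ℝ → Ω} {a b : ℝ} {x y : Ω}, IsCurveIn γ a b x y →
    deltaOmega y * 2 ^ n ≤ deltaOmega x → ENNReal.ofReal (n / 2) ≤ qhLength γ a b := by
  induction n with
  | zero => intro γ a b x y _ _; simp
  | succ n ih =>
    intro γ a b x y h hd
    obtain ⟨hab, hc, rfl, rfl, hr⟩ := id h
    have hx := qx_pos H (γ a)
    have hy := qx_pos H (γ b)
    have h2n : (1:ℝ) ≤ 2 ^ n := one_le_pow₀ (by norm_num)
    have hmem : deltaOmega (γ a) / 2 ∈ Icc (deltaOmega (γ b)) (deltaOmega (γ a)) := by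
      rw [pow_succ] at hd
      constructor
      · nlinarith
      · linarith
    obtain ⟨t, ht, hte⟩ := intermediate_value_Icc' hab (qx_delta_cont.comp_continuousOn hc) hmem
    simp only [Function.comp] at hte
    rw [qx_len_add ht.1 ht.2 hr]
    have c1 := qx_curve_sub h le_rfl ht.1 ht.2
    have c2 := qx_curve_sub h ht.1 ht.2 le_rfl
    have i2 := ih c2 (by rw [hte]; rw [pow_succ] at hd; linarith)
    have i1 := qx_local_curve H (qx_curve_rev 0 c1)
    rw [qx_len_rev 0 c1.1 c1.2.2.2.2] at i1
    have i3 : ENNReal.ofReal (1 / 2) ≤ qhLength γ a t := by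
      refine le_trans (ENNReal.ofReal_le_ofReal ?_) i1
      have h3 : 0 ≤ dist (γ t) (γ a) := dist_nonneg
      have := qx_lip (γ a) (γ t)
      rw [dist_comm] at this
      rw [hte] at this ⊢
      rw [div_le_div_iff₀ (by norm_num) (by positivity)]
      linarith
    calc ENNReal.ofReal (((n + 1 : ℕ) : ℝ) / 2) = ENNReal.ofReal (1 / 2) + ENNReal.ofReal (n / 2) := by
          rw [← ENNReal.ofReal_add (by norm_num) (by positivity)]
          congr 1; push_cast; ring
      _ ≤ _ := add_le_add i3 i2

lemma qx_decay_k (H : QXB Ω) {n : ℕ} {x y : Ω} (h : deltaOmega y * 2 ^ n ≤ deltaOmega x) :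
    (n / 2 : ℝ) ≤ qhDist x y := by
  have : ENNReal.ofReal (n / 2) ≤ qhEDist x y :=
    le_iInf fun γ => le_iInf fun a => le_iInf fun b => le_iInf fun hc => qx_decay H n hc h
  have := ENNReal.toReal_mono (qx_e_ne_top H x y) this
  rwa [ENNReal.toReal_ofReal (by positivity)] at this

/-- `δ` is bounded below on balls -/
lemma qx_delta_lower (H : QXB Ω) (x : Ω) (R : ℝ) :
    ∃ c > 0, ∀ y, qhDist x y ≤ R → c ≤ deltaOmega y := by
  obtain ⟨n, hn⟩ := exists_nat_gt (2 * R)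
  refine ⟨deltaOmega x / 2 ^ n, div_pos (qx_pos H x) (by positivity), ?_⟩
  intro y hy
  by_contra hlt
  push Not at hlt
  rw [lt_div_iff₀ (by positivity)] at hlt
  have := qx_decay_k H hlt.le
  linarith

lemma qx_compact (H : QXB Ω) {c : ℝ} (hc : 0 < c) : IsCompact {y : Ω | c ≤ deltaOmega y} := by
  have := H.cpt
  rw [(UniformSpace.Completion.coe_isometry (α := Ω)).isEmbedding.isCompact_iff]
  have : ((↑) '' {y : Ω | c ≤ deltaOmega y} : Set (UniformSpace.Completion Ω)) =
      {z | c ≤ infDist z (metricBoundary Ω)} := by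
    ext z
    constructor
    · rintro ⟨y, hy, rfl⟩; exact hy
    · intro hz
      have : z ∉ metricBoundary Ω := by
        intro hm
        have := infDist_zero_of_mem hm
        change c ≤ _ at hz
        linarith
      simp only [metricBoundary, mem_compl_iff, not_not] at this
      obtain ⟨y, rfl⟩ := this
      exact ⟨y, hz, rfl⟩
  rw [this]
  exact (isClosed_le continuous_const (Metric.continuous_infDist_pt _)).isCompact

lemma qx_ball_compact (H : QXB Ω) (x : Ω) (R : ℝ) : IsCompact {y : Ω | qhDist x y ≤ R} := by
  obtain ⟨c, hc, h⟩ := qx_delta_lower H x R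
  have hk : Continuous fun y => qhDist x y :=
    continuous_iff_continuousAt.mpr fun y => qx_k_tendsto2 H tendsto_const_nhds tendsto_id
  exact (qx_compact H hc).of_isClosed_subset (isClosed_le hk continuous_const) (fun y hy => h y hy)

lemma qx_ulim (H : QXB Ω) {ι : Type*} (U : Ultrafilter ι) {q : ι → Ω} {x : Ω} {R : ℝ}
    (h : ∀ᶠ n in (U : Filter ι), qhDist x (q n) ≤ R) :
    ∃ p, Tendsto q (U : Filter ι) (𝓝 p) := by
  have := (qx_ball_compact H x R).ultrafilter_le_nhds (U.map q) (by
    rw [le_principal_iff]; exact h)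
  obtain ⟨p, _, hp⟩ := this
  exact ⟨p, hp⟩

lemma qx_three (H : QXB Ω) {γ : ℝ → Ω} {a b s t : ℝ} {x y : Ω} (h : IsCurveIn γ a b x y)
    (has : a ≤ s) (hst : s ≤ t) (htb : t ≤ b) :
    qhDist x (γ s) + qhDist (γ s) (γ t) + qhDist (γ t) y ≤ (qhLength γ a b).toReal := by
  have hf := qx_len_ne_top H h
  have c1 := qx_curve_sub h le_rfl has (hst.trans htb)
  have c2 := qx_curve_sub h has hst htb
  have c3 := qx_curve_sub h (has.trans hst) htb le_rfl
  have e1 := qx_len_add has (hst.trans htb) h.2.2.2.2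
  have e2 := qx_len_add hst htb (qx_rect_right has h.2.2.2.2)
  rw [e1, e2, ENNReal.toReal_add, ENNReal.toReal_add]
  · have k1 := qx_k_le H c1
    have k2 := qx_k_le H c2
    have k3 := qx_k_le H c3
    rw [h.2.2.1] at k1
    rw [h.2.2.2.1] at k3
    linarith
  · exact qx_len_ne_top H c2
  · exact qx_len_ne_top H c3
  · exact qx_len_ne_top H c1
  · exact ENNReal.add_ne_top.mpr ⟨qx_len_ne_top H c2, qx_len_ne_top H c3⟩

lemma qx_approx (H : QXB Ω) (x y : Ω) {ε : ℝ} (hε : 0 < ε) : ∃ q : ℝ → Ω,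
    (∀ t ∈ Icc 0 (qhDist x y), qhDist x (q t) = t) ∧
    (∀ t ∈ Icc 0 (qhDist x y), qhDist (q t) y ≤ qhDist x y - t + ε) ∧
    (∀ t ∈ Icc 0 (qhDist x y), ∀ u ∈ Icc 0 (qhDist x y), qhDist (q t) (q u) ≤ |t - u| + ε) := by
  have hlt : qhEDist x y < ENNReal.ofReal (qhDist x y + ε) := by
    rw [← ENNReal.ofReal_toReal (qx_e_ne_top H x y)]
    exact (ENNReal.ofReal_lt_ofReal_iff (by have := qx_k_nonneg x y; linarith)).mpr
      (by show qhDist x y < _; linarith)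
  rw [qhEDist.eq_def] at hlt
  simp only [iInf_lt_iff] at hlt
  obtain ⟨γ, a, b, h, hl⟩ := hlt
  have hl' : (qhLength γ a b).toReal ≤ qhDist x y + ε := by
    rw [← ENNReal.toReal_ofReal (show 0 ≤ qhDist x y + ε by have := qx_k_nonneg x y; linarith)]
    exact ENNReal.toReal_mono ENNReal.ofReal_ne_top hl.le
  have hcont : ContinuousOn (fun s => qhDist x (γ s)) (Icc a b) := fun s hs =>
    qx_k_tendsto2 H tendsto_const_nhds (h.2.1 s hs)
  have hiv : ∀ t, ∃ s, t ∈ Icc 0 (qhDist x y) → s ∈ Icc a b ∧ qhDist x (γ s) = t := by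
    intro t
    by_cases ht : t ∈ Icc 0 (qhDist x y)
    · have := intermediate_value_Icc h.1 hcont
      rw [h.2.2.1, h.2.2.2.1, qx_k_self] at this
      obtain ⟨s, hs, he⟩ := this ht
      exact ⟨s, fun _ => ⟨hs, he⟩⟩
    · exact ⟨0, fun h' => absurd h' ht⟩
  choose s hs using hiv
  refine ⟨fun t => γ (s t), fun t ht => (hs t ht).2, ?_, ?_⟩
  · intro t ht
    obtain ⟨h1, h2⟩ := hs t ht
    have := qx_three H h h1.1 le_rfl h1.2
    rw [h2, qx_k_self] at this
    linarith
  · have key : ∀ t ∈ Icc 0 (qhDist x y), ∀ u ∈ Icc 0 (qhDist x y), s t ≤ s u →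
        qhDist (γ (s t)) (γ (s u)) ≤ |t - u| + ε := by
      intro t ht u hu hsu
      obtain ⟨h1, h2⟩ := hs t ht
      obtain ⟨h3, h4⟩ := hs u hu
      have a1 := qx_three H h h1.1 hsu h3.2
      have a2 := qx_k_tri H x (γ (s u)) y
      have a3 := neg_le_abs (t - u)
      linarith
    intro t ht u hu
    rcases le_total (s t) (s u) with hsu | hsu
    · exact key t ht u hu hsu
    · have := key u hu t ht hsu
      rw [qx_k_comm, abs_sub_comm]
      exact this

lemma qx_geod (H : QXB Ω) (x y : Ω) : ∃ γ : ℝ → Ω, IsQHGeodesicSeg γ 0 (qhDist x y) x y := by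
  set L := qhDist x y with hL
  have hL0 : 0 ≤ L := qx_k_nonneg x y
  have := fun n : ℕ => qx_approx H x y (ε := 1 / ((n : ℝ) + 1)) (by positivity)
  choose q hq1 hq2 hq3 using this
  let U : Ultrafilter ℕ := Filter.hyperfilter ℕ
  have hU : (U : Filter ℕ) ≤ atTop := by
    rw [← Nat.cofinite_eq_atTop]; exact Filter.hyperfilter_le_cofinite
  have hε : Tendsto (fun n : ℕ => 1 / ((n : ℝ) + 1)) (U : Filter ℕ) (𝓝 0) :=
    tendsto_one_div_add_atTop_nhds_zero_nat.mono_left hU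
  have : ∀ t, ∃ p, t ∈ Icc 0 L → Tendsto (fun n => q n t) (U : Filter ℕ) (𝓝 p) := by
    intro t
    by_cases ht : t ∈ Icc 0 L
    · obtain ⟨p, hp⟩ := qx_ulim H U (q := fun n => q n t) (x := x) (R := L)
        (Eventually.of_forall fun n => (hq1 n t ht).le.trans ht.2)
      exact ⟨p, fun _ => hp⟩
    · exact ⟨x, fun h => absurd h ht⟩
  choose p hp using this
  have p1 : ∀ t ∈ Icc 0 L, qhDist x (p t) = t := by
    intro t ht
    have h1 := qx_k_tendsto2 H (tendsto_const_nhds (x := x)) (hp t ht)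
    refine tendsto_nhds_unique h1 (tendsto_const_nhds.congr fun n => (hq1 n t ht).symm)
  have p2 : ∀ t ∈ Icc 0 L, qhDist (p t) y ≤ L - t := by
    intro t ht
    have h1 := qx_k_tendsto2 H (hp t ht) (tendsto_const_nhds (x := y))
    have h2 := hε.const_add (L - t)
    rw [add_zero] at h2
    exact le_of_tendsto_of_tendsto' h1 h2 fun n => hq2 n t ht
  have p3 : ∀ t ∈ Icc 0 L, ∀ u ∈ Icc 0 L, qhDist (p t) (p u) ≤ |t - u| := by
    intro t ht u hu
    have h1 := qx_k_tendsto2 H (hp t ht) (hp u hu)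
    have h2 := hε.const_add (|t - u|)
    rw [add_zero] at h2
    exact le_of_tendsto_of_tendsto' h1 h2 fun n => hq3 n t ht u hu
  refine ⟨p, hL0, ?_, ?_, ?_⟩
  · exact (qx_eq_of_zero H (p1 0 ⟨le_rfl, hL0⟩)).symm
  · apply qx_eq_of_zero H
    have := p2 L ⟨hL0, le_rfl⟩
    exact le_antisymm (by linarith) (qx_k_nonneg _ _)
  · intro u hu v hv
    apply le_antisymm (p3 u hu v hv)
    have a1 := qx_k_tri H x (p u) (p v)
    have a2 := qx_k_tri H x (p v) (p u)
    rw [qx_k_comm (p v) (p u)] at a2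
    rw [p1 u hu, p1 v hv] at a1 a2
    rw [abs_le]; constructor <;> linarith

lemma qx_chain (H : QXB Ω) (n : ℕ) : ∀ x y : Ω, qhDist x y ≤ n / 2 →
    dist x y ≤ (2 ^ n - 1) * deltaOmega x := by
  induction n with
  | zero =>
    intro x y h
    have := qx_eq_of_zero H (le_antisymm (by simpa using h) (qx_k_nonneg x y))
    simp [this]
  | succ n ih =>
    intro x y h
    obtain ⟨γ, hL0, h0, h1, hg⟩ := qx_geod H x y
    set L := qhDist x y with hL
    have hm : min (1 / 2) L ∈ Icc 0 L := ⟨le_min (by norm_num) hL0, min_le_right _ _⟩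
    set z := γ (min (1 / 2) L) with hz
    have e1 := hg (left_mem_Icc.mpr hL0) hm
    have e2 := hg hm (right_mem_Icc.mpr hL0)
    rw [h0, zero_sub, abs_neg, abs_of_nonneg hm.1] at e1
    rw [h1, abs_sub_comm, abs_of_nonneg (by linarith [hm.2])] at e2
    have d1 := qx_small H (e1.le.trans (min_le_left _ _))
    have hn : (0:ℝ) ≤ n := by positivity
    have d2 := ih z y (by
      rw [e2]
      push_cast at h
      rcases min_choice (1 / 2) L with hc | hc <;> rw [hc] <;> linarith)
    have d3 := qx_lip z x
    rw [dist_comm] at d3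
    have d4 := dist_triangle x z y
    have h2n : (1:ℝ) ≤ 2 ^ n := one_le_pow₀ (by norm_num)
    rw [pow_succ]
    nlinarith [mul_le_mul_of_nonneg_left (d3.trans (add_le_add_right d1 _)) (sub_nonneg.mpr h2n)]

lemma qx_bound (H : QXB Ω) : ∃ M > 0, ∀ x y : Ω, dist x y ≤ M * qhDist x y := by
  have := H.cpt
  obtain ⟨D, hD⟩ := (isCompact_univ (X := UniformSpace.Completion Ω)).isBounded.subset_closedBall
    (qx_bdry_nonempty H).some
  have hd : ∀ z : Ω, deltaOmega z ≤ D := fun z =>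
    (infDist_le_dist_of_mem (qx_bdry_nonempty H).some_mem).trans (hD (mem_univ _))
  have hdd : ∀ x y : Ω, dist x y ≤ 2 * D := fun x y => by
    rw [← UniformSpace.Completion.dist_eq]
    have h1 := dist_triangle_right (x : UniformSpace.Completion Ω) y (qx_bdry_nonempty H).some
    have h2 : dist (x : UniformSpace.Completion Ω) (qx_bdry_nonempty H).some ≤ D := hD (mem_univ _)
    have h3 : dist (y : UniformSpace.Completion Ω) (qx_bdry_nonempty H).some ≤ D := hD (mem_univ _)
    linarith
  refine ⟨3 * |D| + 1, by positivity, fun x y => ?_⟩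
  have h1 := qx_local H x y
  have h2 := hd x
  have h3 := hdd x y
  have h4 := qx_k_nonneg x y
  have h5 := le_abs_self D
  rw [mul_comm]
  refine h1.trans (mul_le_mul_of_nonneg_left ?_ h4)
  linarith

lemma qx_G (H : QXB Ω) (x₀ : Ω) (φ ψ : ℝ → ℝ)
    (hφmono : StrictMonoOn φ (Set.Ioi 0))
    (hψpos : ∀ t > (0:ℝ), 0 < ψ t)
    (hφψ : ∀ t > (0:ℝ), φ (ψ t) = t)
    (hint : ∫⁻ t in Set.Ioi (0:ℝ), ENNReal.ofReal (1 / ψ t) ≠ ⊤)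
    (hgrowth : ∀ x : Ω, qhDist x₀ x ≤ φ (deltaOmega x₀ / deltaOmega x)) :
    ∃ G : ℝ → ℝ, (∀ u, 0 ≤ G u) ∧ Tendsto G atTop (𝓝 0) ∧
      ∀ x, 1 ≤ qhDist x₀ x → deltaOmega x ≤ G (qhDist x₀ x - 1 / 2) - G (qhDist x₀ x) := by
  set f : ℝ → ℝ≥0∞ := fun t => ENNReal.ofReal (1 / ψ t) with hf
  set ν : MeasureTheory.Measure ℝ := (MeasureTheory.volume.restrict (Ioi (0:ℝ))).withDensity f with hν
  have hfin : ν univ ≠ ⊤ := by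
    rw [hν, MeasureTheory.withDensity_apply _ MeasurableSet.univ, MeasureTheory.Measure.restrict_univ]
    exact hint
  have hfin' : ∀ s, ν s ≠ ⊤ := fun s =>
    ne_top_of_le_ne_top hfin (MeasureTheory.measure_mono (subset_univ s))
  have hδ0 := qx_pos H x₀
  refine ⟨fun u => 2 * deltaOmega x₀ * (ν (Ioi u)).toReal, fun u => by positivity, ?_, ?_⟩
  · have h1 := MeasureTheory.tendsto_measure_iInter_atTop (μ := ν) (s := fun u : ℝ => Ioi u)
      (fun i => measurableSet_Ioi.nullMeasurableSet) (fun a b hab => Ioi_subset_Ioi hab)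
      ⟨0, hfin' _⟩
    have h2 : (⋂ n : ℝ, Ioi n) = ∅ := by
      ext x; simp only [mem_iInter, mem_Ioi, mem_empty_iff_false, iff_false, not_forall]
      exact ⟨x, lt_irrefl x⟩
    rw [h2, MeasureTheory.measure_empty] at h1
    have h3 := (ENNReal.tendsto_toReal ENNReal.zero_ne_top).comp h1
    have h4 := h3.const_mul (2 * deltaOmega x₀)
    simpa using h4
  · intro x hx
    set k := qhDist x₀ x with hk
    have hk0 : 0 < k := by linarith
    have hδx := qx_pos H x
    have hψk := hψpos k hk0
    have h1 : ψ k ≤ deltaOmega x₀ / deltaOmega x := by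
      rw [← hφmono.le_iff_le (mem_Ioi.mpr hψk) (mem_Ioi.mpr (div_pos hδ0 hδx)), hφψ k hk0]
      exact hgrowth x
    have h2 : deltaOmega x ≤ deltaOmega x₀ * (1 / ψ k) := by
      rw [mul_one_div, le_div_iff₀ hψk]
      rwa [le_div_iff₀ hδx, mul_comm] at h1
    have h3 : ν (Ioi (k - 1 / 2)) = ν (Ioc (k - 1 / 2) k) + ν (Ioi k) := by
      rw [← MeasureTheory.measure_union _ measurableSet_Ioi, Ioc_union_Ioi_eq_Ioi (by linarith)]
      exact Set.disjoint_left.mpr fun t ht ht' => not_lt.mpr ht.2 ht'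
    have h4 : ENNReal.ofReal (1 / ψ k * (1 / 2)) ≤ ν (Ioc (k - 1 / 2) k) := by
      rw [hν, MeasureTheory.withDensity_apply _ measurableSet_Ioc,
        MeasureTheory.Measure.restrict_restrict measurableSet_Ioc,
        inter_eq_left.mpr (fun t ht => by have := ht.1; show 0 < t; linarith)]
      calc ENNReal.ofReal (1 / ψ k * (1 / 2))
          = ∫⁻ t in Ioc (k - 1 / 2) k, ENNReal.ofReal (1 / ψ k) := by
            rw [MeasureTheory.setLIntegral_const, Real.volume_Ioc, ← ENNReal.ofReal_mul (by positivity)]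
            congr 2; ring
        _ ≤ _ := by
            apply MeasureTheory.setLIntegral_mono' measurableSet_Ioc
            intro t ht
            have ht0 : 0 < t := by linarith [ht.1]
            apply ENNReal.ofReal_le_ofReal
            apply one_div_le_one_div_of_le (hψpos t ht0)
            rw [← hφmono.le_iff_le (mem_Ioi.mpr (hψpos t ht0)) (mem_Ioi.mpr hψk), hφψ t ht0, hφψ k hk0]
            exact ht.2
    have h5 := ENNReal.toReal_mono (hfin' _) h4
    rw [ENNReal.toReal_ofReal (by positivity)] at h5
    show _ ≤ 2 * deltaOmega x₀ * (ν (Ioi (k - 1 / 2))).toReal - 2 * deltaOmega x₀ * (ν (Ioi k)).toReal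
    rw [h3, ENNReal.toReal_add (hfin' _) (hfin' _)]
    nlinarith [mul_le_mul_of_nonneg_left h5 hδ0.le]

/-- the growth package -/
structure QXG (x₀ : Ω) (G : ℝ → ℝ) : Prop where
  base : QXB Ω
  nonneg : ∀ u, 0 ≤ G u
  lim : Tendsto G atTop (𝓝 0)
  bd : ∀ x : Ω, 1 ≤ qhDist x₀ x → deltaOmega x ≤ G (qhDist x₀ x - 1 / 2) - G (qhDist x₀ x)

lemma qx_geo_k {x₀ : Ω} {γ : ℝ → Ω} {s : Set ℝ} (hg : IsQHGeodesicOn γ s) (h0 : γ 0 = x₀)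
    (hs : (0:ℝ) ∈ s) {t : ℝ} (ht : t ∈ s) (ht0 : 0 ≤ t) : qhDist x₀ (γ t) = t := by
  have := hg hs ht
  rwa [h0, zero_sub, abs_neg, abs_of_nonneg ht0] at this

lemma qx_geo_delta {x₀ : Ω} {G : ℝ → ℝ} (P : QXG x₀ G) {γ : ℝ → Ω} {T : ℝ}
    (hg : IsQHGeodesicOn γ (Icc 0 T)) (h0 : γ 0 = x₀) {s : ℝ} (hs : 1 ≤ s) (hsT : s ≤ T) :
    deltaOmega (γ s) ≤ G (s - 1 / 2) - G s := by
  have e := qx_geo_k hg h0 ⟨le_rfl, by linarith⟩ (t := s) ⟨by linarith, hsT⟩ (by linarith)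
  have := P.bd (γ s) (by rw [e]; exact hs)
  rwa [e] at this

lemma qx_tail {x₀ : Ω} {G : ℝ → ℝ} (P : QXG x₀ G) {γ : ℝ → Ω} {T : ℝ}
    (hg : IsQHGeodesicOn γ (Icc 0 T)) (h0 : γ 0 = x₀) (n : ℕ) :
    ∀ s, 1 ≤ s → s ≤ T → T - s ≤ n / 2 → dist (γ s) (γ T) ≤ G (s - 1 / 2) := by
  induction n with
  | zero =>
    intro s hs hsT h
    have : s = T := by
      have : T - s ≤ 0 := by simpa using h
      linarith
    rw [this, dist_self]; exact P.nonneg _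
  | succ n ih =>
    intro s hs hsT h
    have hd := qx_geo_delta P hg h0 hs hsT
    rcases le_total (T - s) (1 / 2) with hc | hc
    · have e := hg (u := s) ⟨by linarith, hsT⟩ (v := T) ⟨by linarith, le_rfl⟩
      rw [abs_sub_comm, abs_of_nonneg (by linarith)] at e
      have := qx_small P.base (e.le.trans hc)
      linarith [P.nonneg s]
    · have e := hg (u := s) ⟨by linarith, hsT⟩ (v := s + 1 / 2) ⟨by linarith, by linarith⟩
      rw [abs_sub_comm, abs_of_nonneg (by linarith), add_sub_cancel_left] at e
      have h1 := qx_small P.base e.le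
      have h2 := ih (s + 1 / 2) (by linarith) (by linarith) (by push_cast at h; linarith)
      rw [add_sub_cancel_right] at h2
      linarith [dist_triangle (γ s) (γ (s + 1 / 2)) (γ T)]

lemma qx_tail' {x₀ : Ω} {G : ℝ → ℝ} (P : QXG x₀ G) {γ : ℝ → Ω} {T : ℝ}
    (hg : IsQHGeodesicOn γ (Icc 0 T)) (h0 : γ 0 = x₀) {s : ℝ} (hs : 1 ≤ s) (hsT : s ≤ T) :
    dist (γ s) (γ T) ≤ G (s - 1 / 2) := by
  obtain ⟨n, hn⟩ := exists_nat_ge (2 * (T - s))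
  exact qx_tail P hg h0 n s hs hsT (by linarith)

lemma qx_ray_seg {γ : ℝ → Ω} (h : IsQHGeodesicRay γ) (T : ℝ) : IsQHGeodesicOn γ (Icc 0 T) :=
  fun _ hu _ hv => h hu.1 hv.1

lemma qx_G_shift {x₀ : Ω} {G : ℝ → ℝ} (P : QXG x₀ G) :
    Tendsto (fun s => G (s - 1 / 2)) atTop (𝓝 0) :=
  P.lim.comp (tendsto_atTop_add_const_right _ (-(1 / 2)) tendsto_id)

lemma qx_ray_delta {x₀ : Ω} {G : ℝ → ℝ} (P : QXG x₀ G) (γ : RaySpace Ω x₀) :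
    Tendsto (fun t => deltaOmega (γ.1 t)) atTop (𝓝 0) := by
  refine tendsto_of_tendsto_of_tendsto_of_le_of_le' tendsto_const_nhds (qx_G_shift P)
    (Eventually.of_forall fun t => (qx_pos P.base _).le) ?_
  filter_upwards [eventually_ge_atTop 1] with t ht
  have := qx_geo_delta P (qx_ray_seg γ.2.1 t) γ.2.2 ht le_rfl
  linarith [P.nonneg t]

lemma qx_ray_lim {x₀ : Ω} {G : ℝ → ℝ} (P : QXG x₀ G) (γ : RaySpace Ω x₀) :
    ∃ p ∈ metricBoundary Ω,
      Tendsto (fun t : ℝ => ((γ.1 t : Ω) : UniformSpace.Completion Ω)) atTop (𝓝 p) := by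
  have hc : CauchySeq (fun t : ℝ => ((γ.1 t : Ω) : UniformSpace.Completion Ω)) := by
    rw [Metric.cauchySeq_iff']
    intro ε hε
    obtain ⟨N, hN1, hN2⟩ := ((qx_G_shift P).eventually (gt_mem_nhds hε) |>.and
      (eventually_ge_atTop 1)).exists
    refine ⟨N, fun n hn => ?_⟩
    rw [UniformSpace.Completion.dist_eq, dist_comm]
    exact (qx_tail' P (qx_ray_seg γ.2.1 n) γ.2.2 hN2 hn).trans_lt hN1
  obtain ⟨p, hp⟩ := cauchySeq_tendsto_of_complete hc
  refine ⟨p, ?_, hp⟩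
  rintro ⟨y, rfl⟩
  have h1 : Tendsto (fun t => deltaOmega (γ.1 t)) atTop (𝓝 (deltaOmega y)) :=
    ((Metric.continuous_infDist_pt (metricBoundary Ω)).tendsto _).comp hp
  have := tendsto_nhds_unique h1 (qx_ray_delta P γ)
  exact (qx_pos P.base y).ne' this

lemma qx_ray_bound {x₀ : Ω} {G : ℝ → ℝ} (P : QXG x₀ G) (γ : RaySpace Ω x₀)
    {p : UniformSpace.Completion Ω}
    (hp : Tendsto (fun t : ℝ => ((γ.1 t : Ω) : UniformSpace.Completion Ω)) atTop (𝓝 p))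
    {s : ℝ} (hs : 1 ≤ s) : dist (γ.1 s : UniformSpace.Completion Ω) p ≤ G (s - 1 / 2) := by
  have h1 := (tendsto_const_nhds (x := (γ.1 s : UniformSpace.Completion Ω))).dist hp
  refine le_of_tendsto h1 ?_
  filter_upwards [eventually_ge_atTop s] with t ht
  rw [UniformSpace.Completion.dist_eq]
  exact qx_tail' P (qx_ray_seg γ.2.1 t) γ.2.2 hs ht

lemma qx_equiv_lim {x₀ : Ω} {G : ℝ → ℝ} (P : QXG x₀ G) {γ σ : RaySpace Ω x₀}
    (h : RayEquiv x₀ γ σ) {p : UniformSpace.Completion Ω}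
    (hp : Tendsto (fun t : ℝ => ((γ.1 t : Ω) : UniformSpace.Completion Ω)) atTop (𝓝 p)) :
    Tendsto (fun t : ℝ => ((σ.1 t : Ω) : UniformSpace.Completion Ω)) atTop (𝓝 p) := by
  obtain ⟨M, hM⟩ := h
  obtain ⟨n, hn⟩ := exists_nat_ge (2 * M)
  have h1 : Tendsto (fun t => (2 ^ n - 1) * deltaOmega (γ.1 t)) atTop (𝓝 0) := by
    simpa using (qx_ray_delta P γ).const_mul ((2:ℝ) ^ n - 1)
  refine (tendsto_iff_of_dist ?_).mp hp
  refine squeeze_zero' (Eventually.of_forall fun _ => dist_nonneg) ?_ h1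
  filter_upwards [eventually_ge_atTop 0] with t ht
  rw [UniformSpace.Completion.dist_eq]
  exact qx_chain P.base n _ _ ((hM t ht).trans (by linarith))

lemma qx_lim_equiv {x₀ : Ω} {G : ℝ → ℝ} (P : QXG x₀ G) (hhyp : QHGromovHyperbolic Ω)
    (hgh : GehringHayman Ω) {γ σ : RaySpace Ω x₀} {p : UniformSpace.Completion Ω}
    (hp : Tendsto (fun t : ℝ => ((γ.1 t : Ω) : UniformSpace.Completion Ω)) atTop (𝓝 p))
    (hp' : Tendsto (fun t : ℝ => ((σ.1 t : Ω) : UniformSpace.Completion Ω)) atTop (𝓝 p)) :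
    RayEquiv x₀ γ σ := by
  have H := P.base
  obtain ⟨D, hD, hthin⟩ := hhyp
  obtain ⟨C, hC, hGH⟩ := hgh
  obtain ⟨A, hA, hqc⟩ := H.qc
  refine ⟨2 * D, fun t ht => ?_⟩
  obtain ⟨c, hc, hlow⟩ := qx_delta_lower H x₀ (t + D)
  have hdist : Tendsto (fun s => C * (A * dist (γ.1 s) (σ.1 s))) atTop (𝓝 0) := by
    have := hp.dist hp'
    simp only [UniformSpace.Completion.dist_eq, dist_self] at this
    simpa using (this.const_mul A).const_mul C
  obtain ⟨N, ⟨hN1, hN2⟩, hN3⟩ := (((qx_ray_delta P γ).eventually (gt_mem_nhds (half_pos hc))).and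
    (hdist.eventually (gt_mem_nhds (half_pos hc))) |>.and (eventually_ge_atTop t)).exists
  obtain ⟨β, hβ⟩ := qx_geod H (γ.1 N) (σ.1 N)
  obtain ⟨τ, a, b, hτ, hτl⟩ := hqc (γ.1 N) (σ.1 N)
  have hvar := (hGH _ _ β _ _ hβ τ a b hτ).trans (mul_le_mul_right hτl _)
  rw [← ENNReal.ofReal_mul (by linarith)] at hvar
  have hnn : 0 ≤ C * (A * dist (γ.1 N) (σ.1 N)) := by positivity
  have hβδ : ∀ u ∈ Icc 0 (qhDist (γ.1 N) (σ.1 N)), deltaOmega (β u) < c := by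
    intro u hu
    have e1 := (eVariationOn.edist_le β hu (left_mem_Icc.mpr hβ.1)).trans hvar
    have e2 : dist (β u) (γ.1 N) ≤ C * (A * dist (γ.1 N) (σ.1 N)) := by
      rw [hβ.2.1] at e1
      rw [dist_edist, ← ENNReal.toReal_ofReal hnn]
      exact ENNReal.toReal_mono ENNReal.ofReal_ne_top e1
    have := qx_lip (β u) (γ.1 N)
    linarith
  have hN0 : 0 ≤ N := ht.trans hN3
  have kγ : ∀ {t}, 0 ≤ t → qhDist x₀ (γ.1 t) = t := fun h =>
    qx_geo_k γ.2.1 γ.2.2 self_mem_Ici h h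
  have kσ : ∀ {t}, 0 ≤ t → qhDist x₀ (σ.1 t) = t := fun h =>
    qx_geo_k σ.2.1 σ.2.2 self_mem_Ici h h
  obtain ⟨u, hu | hu⟩ := hthin x₀ (γ.1 N) (σ.1 N) γ.1 β σ.1 0 N 0 _ 0 N
    ⟨hN0, γ.2.2, rfl, qx_ray_seg γ.2.1 N⟩ hβ ⟨hN0, σ.2.2, rfl, qx_ray_seg σ.2.1 N⟩ t ⟨ht, hN3⟩
  · exfalso
    have h1 := qx_k_tri H x₀ (γ.1 t) (β u)
    rw [kγ ht] at h1
    have h2 := hlow (β u) (by linarith [hu.2])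
    linarith [hβδ u hu.1]
  · have h1 := qx_k_tri H x₀ (γ.1 t) (σ.1 u)
    have h2 := qx_k_tri H x₀ (σ.1 u) (γ.1 t)
    rw [qx_k_comm (σ.1 u)] at h2
    rw [kγ ht, kσ hu.1.1] at h1 h2
    have h3 := qx_k_tri H (γ.1 t) (σ.1 u) (σ.1 t)
    have h4 : qhDist (σ.1 u) (σ.1 t) = |u - t| := σ.2.1 hu.1.1 ht
    have h5 : |u - t| ≤ D := by rw [abs_le]; constructor <;> linarith [hu.2]
    linarith [hu.2]

lemma qx_surj {x₀ : Ω} {G : ℝ → ℝ} (P : QXG x₀ G) {p : UniformSpace.Completion Ω}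
    (hp : p ∈ metricBoundary Ω) : ∃ γ : RaySpace Ω x₀, (∀ t ≤ 0, γ.1 t = x₀) ∧
      Tendsto (fun t : ℝ => ((γ.1 t : Ω) : UniformSpace.Completion Ω)) atTop (𝓝 p) := by
  have H := P.base
  have hcl : p ∈ closure (range ((↑) : Ω → UniformSpace.Completion Ω)) :=
    UniformSpace.Completion.denseRange_coe p
  obtain ⟨x', hx', hlim'⟩ := mem_closure_iff_seq_limit.mp hcl
  choose x hx using hx'
  have hlim : Tendsto (fun n => (x n : UniformSpace.Completion Ω)) atTop (𝓝 p) := by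
    simpa only [hx] using hlim'
  have hδ : Tendsto (fun n => deltaOmega (x n)) atTop (𝓝 0) := by
    have := ((Metric.continuous_infDist_pt (metricBoundary Ω)).tendsto p).comp hlim
    rwa [infDist_zero_of_mem hp] at this
  have hT : ∀ R, ∀ᶠ n in atTop, R ≤ qhDist x₀ (x n) := by
    intro R
    obtain ⟨c, hc, hlow⟩ := qx_delta_lower H x₀ R
    filter_upwards [hδ.eventually (gt_mem_nhds hc)] with n hn
    by_contra hcon
    push Not at hcon
    linarith [hlow _ hcon.le]
  choose g hg using fun n => qx_geod H x₀ (x n)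
  let U : Ultrafilter ℕ := Filter.hyperfilter ℕ
  have hU : (U : Filter ℕ) ≤ atTop := by
    rw [← Nat.cofinite_eq_atTop]; exact Filter.hyperfilter_le_cofinite
  have hTU : ∀ R, ∀ᶠ n in (U : Filter ℕ), R ≤ qhDist x₀ (x n) := fun R => hU (hT R)
  have hk : ∀ n t, 0 ≤ t → t ≤ qhDist x₀ (x n) → qhDist x₀ (g n t) = t := fun n t h1 h2 =>
    qx_geo_k (hg n).2.2.2 (hg n).2.1 (left_mem_Icc.mpr (hg n).1) ⟨h1, h2⟩ h1
  have : ∀ t, ∃ q, 0 ≤ t → Tendsto (fun n => g n t) (U : Filter ℕ) (𝓝 q) := by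
    intro t
    by_cases ht : 0 ≤ t
    · obtain ⟨q, hq⟩ := qx_ulim H U (q := fun n => g n t) (x := x₀) (R := t) (by
        filter_upwards [hTU t] with n hn
        exact (hk n t ht hn).le)
      exact ⟨q, fun _ => hq⟩
    · exact ⟨x₀, fun h => absurd h ht⟩
  choose q hq using this
  have hq0 : q 0 = x₀ := by
    refine tendsto_nhds_unique (hq 0 le_rfl) (tendsto_const_nhds.congr fun n => (hg n).2.1.symm)
  let f : ℝ → Ω := fun t => if 0 ≤ t then q t else x₀
  have hf : ∀ t, 0 ≤ t → f t = q t := fun t ht => if_pos ht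
  have hray : IsQHGeodesicRay f := by
    intro u hu v hv
    rw [hf u hu, hf v hv]
    refine tendsto_nhds_unique (qx_k_tendsto2 H (hq u hu) (hq v hv)) ?_
    apply tendsto_const_nhds.congr'
    filter_upwards [hTU u, hTU v] with n h1 h2
    exact ((hg n).2.2.2 ⟨hu, h1⟩ ⟨hv, h2⟩).symm
  refine ⟨⟨f, hray, by rw [hf 0 le_rfl, hq0]⟩, ?_, ?_⟩
  · intro t ht
    rcases ht.eq_or_lt with rfl | h
    · show f 0 = x₀
      rw [hf 0 le_rfl, hq0]
    · show f t = x₀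
      exact if_neg (not_le.mpr h)
  · show Tendsto (fun t => ((f t : Ω) : UniformSpace.Completion Ω)) atTop (𝓝 p)
    rw [tendsto_iff_dist_tendsto_zero]
    refine squeeze_zero' (Eventually.of_forall fun _ => dist_nonneg) ?_ (qx_G_shift P)
    filter_upwards [eventually_ge_atTop 1] with s hs
    have hs0 : 0 ≤ s := by linarith
    rw [hf s hs0]
    have h1 : Tendsto (fun n => ((g n s : Ω) : UniformSpace.Completion Ω)) (U : Filter ℕ)
        (𝓝 (q s : UniformSpace.Completion Ω)) :=
      ((UniformSpace.Completion.continuous_coe Ω).tendsto _).comp (hq s hs0)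
    refine le_of_tendsto (h1.dist (hlim.mono_left hU)) ?_
    filter_upwards [hTU s] with n hn
    rw [UniformSpace.Completion.dist_eq]
    have := qx_tail' P (hg n).2.2.2 (hg n).2.1 hs hn
    rwa [(hg n).2.2.1] at this

lemma qx_eval_cont {x₀ : Ω} (s : ℝ) : Continuous fun γ : RaySpace Ω x₀ => γ.1 s := by
  have h1 := (UniformOnFun.uniformContinuous_eval_of_mem Ω {K : Set ℝ | IsCompact K}
    (mem_singleton s) (isCompact_singleton (x := s))).continuous
  exact h1.comp continuous_induced_dom

lemma qx_cont {x₀ : Ω} {G : ℝ → ℝ} (P : QXG x₀ G) (L : RaySpace Ω x₀ → UniformSpace.Completion Ω)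
    (hL : ∀ γ : RaySpace Ω x₀,
      Tendsto (fun t : ℝ => ((γ.1 t : Ω) : UniformSpace.Completion Ω)) atTop (𝓝 (L γ))) :
    Continuous L := by
  rw [continuous_iff_continuousAt]
  intro γ
  rw [ContinuousAt, Metric.tendsto_nhds]
  intro ε hε
  obtain ⟨s, hs1, hs2⟩ := ((qx_G_shift P).eventually (gt_mem_nhds (show 0 < ε / 3 by linarith)) |>.and
      (eventually_ge_atTop 1)).exists
  have := (qx_eval_cont (x₀ := x₀) s).continuousAt (x := γ)
  rw [ContinuousAt, Metric.tendsto_nhds] at this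
  filter_upwards [this (ε / 3) (by linarith)] with σ hσ
  rw [← UniformSpace.Completion.dist_eq] at hσ
  have h1 := qx_ray_bound P σ (hL σ) hs2
  have h2 := qx_ray_bound P γ (hL γ) hs2
  have h3 := dist_triangle4 (L σ) (σ.1 s : UniformSpace.Completion Ω) (γ.1 s) (L γ)
  rw [dist_comm (L σ) (σ.1 s : UniformSpace.Completion Ω)] at h3
  linarith

lemma qx_compact_rays (H : QXB Ω) (x₀ : Ω) :
    CompactSpace {γ : RaySpace Ω x₀ // ∀ t ≤ 0, γ.1 t = x₀} := by
  obtain ⟨M, hM, hMk⟩ := qx_bound H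
  have hev : ∀ s : ℝ, Continuous fun g : UniformOnFun ℝ Ω {K : Set ℝ | IsCompact K} =>
      UniformOnFun.toFun {K : Set ℝ | IsCompact K} g s := fun s =>
    (UniformOnFun.uniformContinuous_eval_of_mem Ω {K : Set ℝ | IsCompact K}
      (mem_singleton s) (isCompact_singleton (x := s))).continuous
  apply ArzelaAscoli.compactSpace_of_closed_inducing'
    (F := fun γ : {γ : RaySpace Ω x₀ // ∀ t ≤ 0, γ.1 t = x₀} => γ.1.1)
    (𝔖 := {K : Set ℝ | IsCompact K})
  · exact fun K hK => hK
  · exact (Topology.IsInducing.mk rfl : Topology.IsInducing (fun γ : RaySpace Ω x₀ =>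
      UniformOnFun.ofFun {K : Set ℝ | IsCompact K} γ.1)).comp Topology.IsInducing.subtypeVal
  · have : range (UniformOnFun.ofFun {K : Set ℝ | IsCompact K} ∘
        fun γ : {γ : RaySpace Ω x₀ // ∀ t ≤ 0, γ.1 t = x₀} => γ.1.1) =
        (⋂ u ∈ Ici (0:ℝ), ⋂ v ∈ Ici (0:ℝ), {g | qhDist
          (UniformOnFun.toFun {K : Set ℝ | IsCompact K} g u)
          (UniformOnFun.toFun {K : Set ℝ | IsCompact K} g v) = |u - v|}) ∩
        ⋂ t ∈ Iic (0:ℝ), {g | UniformOnFun.toFun {K : Set ℝ | IsCompact K} g t = x₀} := by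
      ext g
      constructor
      · rintro ⟨γ, rfl⟩
        refine ⟨?_, ?_⟩
        · simp only [mem_iInter]
          intro u hu v hv
          exact γ.1.2.1 hu hv
        · simp only [mem_iInter]
          intro t ht
          exact γ.2 t ht
      · rintro ⟨h1, h2⟩
        simp only [mem_iInter] at h1 h2
        exact ⟨⟨⟨UniformOnFun.toFun _ g, fun u hu v hv => h1 u hu v hv, h2 0 self_mem_Iic⟩,
          fun t ht => h2 t ht⟩, rfl⟩
    rw [this]
    refine IsClosed.inter ?_ ?_
    · refine isClosed_biInter fun u _ => isClosed_biInter fun v _ => ?_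
      refine isClosed_eq ?_ continuous_const
      exact continuous_iff_continuousAt.mpr fun g =>
        qx_k_tendsto2 H ((hev u).tendsto g) ((hev v).tendsto g)
    · exact isClosed_biInter fun t _ => isClosed_eq (hev t) continuous_const
  · intro K _
    apply Equicontinuous.equicontinuousOn
    apply Metric.equicontinuous_of_continuity_modulus (fun r => M * r)
    · have : Tendsto (fun r : ℝ => M * r) (𝓝 0) (𝓝 (M * 0)) := tendsto_id.const_mul M
      simpa using this
    · intro u v γ
      have hmax : ∀ t, γ.1.1 t = γ.1.1 (max t 0) := by
        intro t
        rcases le_total t 0 with h | h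
        · rw [max_eq_right h, γ.2 t h, γ.2 0 le_rfl]
        · rw [max_eq_left h]
      rw [hmax u, hmax v]
      refine (hMk _ _).trans (mul_le_mul_of_nonneg_left ?_ hM.le)
      rw [γ.1.2.1 (le_max_right u 0) (le_max_right v 0), Real.dist_eq]
      exact abs_max_sub_max_le_abs u v 0
  · intro K _ t _
    refine ⟨{y | qhDist x₀ y ≤ |t|}, qx_ball_compact H x₀ _, fun γ => ?_⟩
    show qhDist x₀ (γ.1.1 t) ≤ |t|
    rcases le_total t 0 with h | h
    · rw [γ.2 t h, qx_k_self]; positivity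
    · rw [qx_geo_k γ.1.2.1 γ.1.2.2 self_mem_Ici h h]
      exact le_abs_self t

lemma qx_main {x₀ : Ω} {G : ℝ → ℝ} (P : QXG x₀ G) (hhyp : QHGromovHyperbolic Ω)
    (hgh : GehringHayman Ω) :
    ∃ Φ : GromovBoundary Ω x₀ ≃ₜ (metricBoundary Ω : Set (UniformSpace.Completion Ω)),
      ∀ γ : RaySpace Ω x₀,
        Filter.Tendsto (fun t : ℝ => ((γ.1 t : Ω) : UniformSpace.Completion Ω))
          Filter.atTop (nhds ((Φ (Quot.mk (RayEquiv x₀) γ) : UniformSpace.Completion Ω))) := by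
  choose L hLm hL using fun γ : RaySpace Ω x₀ => qx_ray_lim P γ
  have hLc : Continuous L := qx_cont P L hL
  let F : RaySpace Ω x₀ → metricBoundary Ω := fun γ => ⟨L γ, hLm γ⟩
  have hFc : Continuous F := hLc.subtype_mk _
  have hFe : ∀ γ σ, RayEquiv x₀ γ σ → F γ = F σ := fun γ σ h =>
    Subtype.ext (tendsto_nhds_unique (qx_equiv_lim P h (hL γ)) (hL σ))
  let Φ₀ : GromovBoundary Ω x₀ → metricBoundary Ω := Quot.lift F hFe
  have hΦc : Continuous Φ₀ := continuous_quot_lift hFe hFc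
  have hsurj : Function.Surjective Φ₀ := by
    rintro ⟨p, hp⟩
    obtain ⟨γ, _, hγ⟩ := qx_surj P hp
    exact ⟨Quot.mk _ γ, Subtype.ext (tendsto_nhds_unique (hL γ) hγ)⟩
  have hinj : Function.Injective Φ₀ := by
    intro a b hab
    induction a using Quot.ind with
    | mk γ =>
      induction b using Quot.ind with
      | mk σ =>
        apply Quot.sound
        have e : L γ = L σ := congrArg Subtype.val hab
        exact qx_lim_equiv P hhyp hgh (hL γ) (e ▸ hL σ)
  have hcs : CompactSpace (GromovBoundary Ω x₀) := by
    have := qx_compact_rays P.base x₀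
    let j : {γ : RaySpace Ω x₀ // ∀ t ≤ 0, γ.1 t = x₀} → GromovBoundary Ω x₀ :=
      fun γ => Quot.mk _ γ.1
    have hj : Continuous j := continuous_quot_mk.comp continuous_subtype_val
    have hjs : Function.Surjective j := by
      intro a
      obtain ⟨γ, h0, hγ⟩ := qx_surj P (Φ₀ a).2
      refine ⟨⟨γ, h0⟩, hinj (Subtype.ext (tendsto_nhds_unique (hL γ) hγ))⟩
    exact hjs.compactSpace hj
  refine ⟨Continuous.homeoOfEquivCompactToT2 (f := Equiv.ofBijective Φ₀ ⟨hinj, hsurj⟩) hΦc, ?_⟩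
  intro γ
  exact hL γ


/-- **Theorem (Lammi; via Main-1 and Main-2).**  Let `(Ω,d)` be a bounded minimally nice
space with compact metric completion, with `(Ω,k_Ω)` Gromov hyperbolic, `(Ω,d)` quasiconvex
and satisfying the Gehring–Hayman theorem.  If `k_Ω(x₀,x) ≤ φ(δ_Ω(x₀)/δ_Ω(x))` for a strictly
increasing `φ : (0,∞) → (0,∞)` with `φ(t) → ∞` and `∫₀^∞ dt/φ⁻¹(t) < ∞` (with `ψ = φ⁻¹`),
then the identity `(Ω,k_Ω) → (Ω,d)` extends to a homeomorphism `∂_GΩ → ∂_dΩ`. -/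
theorem gromov_boundary_homeomorphic_metric_boundary_of_growth
    {Ω : Type*} [MetricSpace Ω]
    (hnice : MinimallyNice Ω)
    (hbdd : Bornology.IsBounded (Set.univ : Set Ω))
    (hcpt : CompactSpace (UniformSpace.Completion Ω))
    (hhyp : QHGromovHyperbolic Ω)
    (hqc : QuasiconvexSpace Ω)
    (hgh : GehringHayman Ω)
    (x₀ : Ω) (φ ψ : ℝ → ℝ)
    (hφpos : ∀ t > (0:ℝ), 0 < φ t)
    (hφmono : StrictMonoOn φ (Set.Ioi 0))
    (hφtop : Filter.Tendsto φ Filter.atTop Filter.atTop)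
    (hψpos : ∀ t > (0:ℝ), 0 < ψ t)
    (hψφ : ∀ t > (0:ℝ), ψ (φ t) = t)
    (hφψ : ∀ t > (0:ℝ), φ (ψ t) = t)
    (hint : ∫⁻ t in Set.Ioi (0:ℝ), ENNReal.ofReal (1 / ψ t) ≠ ⊤)
    (hgrowth : ∀ x : Ω, qhDist x₀ x ≤ φ (deltaOmega x₀ / deltaOmega x)) :
    ∃ Φ : GromovBoundary Ω x₀ ≃ₜ (metricBoundary Ω : Set (UniformSpace.Completion Ω)),
      ∀ γ : RaySpace Ω x₀,
        Filter.Tendsto (fun t : ℝ => ((γ.1 t : Ω) : UniformSpace.Completion Ω))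
          Filter.atTop (nhds ((Φ (Quot.mk (RayEquiv x₀) γ) : UniformSpace.Completion Ω))) := by
  have H : QXB Ω := ⟨hnice, hcpt, hqc⟩
  obtain ⟨G, hG0, hG1, hG2⟩ := qx_G H x₀ φ ψ hφmono hψpos hφψ hint hgrowth
  exact qx_main ⟨H, hG0, hG1, hG2⟩ hhyp hgh
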